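/- Let k ≥ 2, m ≥ 1, d = mk, and let C̃ = (k/(k−1))·(I_d − (1/k)(1_{k×k} ⊗ I_m)) ∈ ℝ^{d×d}. If z ∈ ℝ^d is feasible (z ≥ 0 entrywise, ‖Σ_b z^b‖₂² = 1), then z^T C̃ z = (k/(k−1))·(‖z‖₂² − 1/k) ≤ 1. Moreover, for any two feasible z, w ∈ ℝ^d, z^T C̃ w ≤ 1. -/

import Mathlib

open Matrix
open scoped Kronecker

/-- The matrix `C̃ = (k/(k−1))·(I_d − (1/k)(1_{k×k} ⊗ I_m))` of the `M⁴+`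
relaxation, with `ℝ^{mk}` indexed by block `b ∈ [k]` and in-block index
`j ∈ [m]`. -/
noncomputable def simplexQuadMatrix (k m : ℕ) :
    Matrix (Fin k × Fin m) (Fin k × Fin m) ℝ :=
  ((k : ℝ) / ((k : ℝ) - 1)) •
    ((1 : Matrix (Fin k × Fin m) (Fin k × Fin m) ℝ) -
      ((1 : ℝ) / (k : ℝ)) •
        ((Matrix.of fun _ _ : Fin k => (1 : ℝ)) ⊗ₖ (1 : Matrix (Fin m) (Fin m) ℝ)))

/-- The bilinear form of `simplexQuadMatrix` in terms of entries and block sums. -/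
theorem dotProduct_simplexQuadMatrix_mulVec (k m : ℕ) (z w : Fin k × Fin m → ℝ) :
    z ⬝ᵥ (simplexQuadMatrix k m *ᵥ w) =
      ((k : ℝ) / ((k : ℝ) - 1)) * ((∑ p, z p * w p) -
        1 / (k : ℝ) * ∑ j, (∑ b, z (b, j)) * ∑ b, w (b, j)) := by
  have kronecker_form : z ⬝ᵥ (((Matrix.of fun _ _ : Fin k => (1 : ℝ)) ⊗ₖ
      (1 : Matrix (Fin m) (Fin m) ℝ)) *ᵥ w) = ∑ j, (∑ b, z (b, j)) * ∑ b, w (b, j) := by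
    simp only [dotProduct, mulVec, kroneckerMap_apply, of_apply, one_mul, one_apply,
      Fintype.sum_prod_type, ite_mul, zero_mul, Finset.sum_ite_eq, Finset.mem_univ, if_true]
    rw [Finset.sum_comm]
    simp only [Finset.sum_mul]
  rw [simplexQuadMatrix, smul_mulVec, sub_mulVec, smul_mulVec, one_mulVec, dotProduct_smul,
    dotProduct_sub, dotProduct_smul, kronecker_form]
  rfl

/-- For nonnegative vectors, the inner product is at most the inner product of the block sums. -/
theorem sum_mul_le_sum_blockSum_mul {ι κ : Type*} [Fintype ι] [Fintype κ] {z w : ι × κ → ℝ}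
    (hz : ∀ p, 0 ≤ z p) (hw : ∀ p, 0 ≤ w p) :
    ∑ p, z p * w p ≤ ∑ j, (∑ b, z (b, j)) * ∑ b, w (b, j) := by
  rw [Fintype.sum_prod_type_right]
  refine Finset.sum_le_sum fun j _ => ?_
  rw [Finset.sum_mul]
  exact Finset.sum_le_sum fun b _ => mul_le_mul_of_nonneg_left
    (Finset.single_le_sum (f := fun b => w (b, j)) (fun b _ => hw (b, j)) (Finset.mem_univ b))
    (hz (b, j))

/-- If the block sums of two nonnegative vectors have unit norm, then
`simplexQuadMatrix` pairs them to at most one. -/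
theorem dotProduct_simplexQuadMatrix_mulVec_le_one {k m : ℕ} (hk : 2 ≤ k)
    {z w : Fin k × Fin m → ℝ} (hz : ∀ p, 0 ≤ z p) (hz_sum : ∑ j, (∑ b, z (b, j)) ^ 2 = 1)
    (hw : ∀ p, 0 ≤ w p) (hw_sum : ∑ j, (∑ b, w (b, j)) ^ 2 = 1) :
    z ⬝ᵥ (simplexQuadMatrix k m *ᵥ w) ≤ 1 := by
  have hk' : (2 : ℝ) ≤ k := by exact_mod_cast hk
  have hk_sub : (0 : ℝ) < k - 1 := by linarith
  have blockSum_le : ∑ j, (∑ b, z (b, j)) * ∑ b, w (b, j) ≤ 1 := by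
    have h := Finset.sum_le_sum fun j (_ : j ∈ Finset.univ) =>
      two_mul_le_add_sq (∑ b, z (b, j)) (∑ b, w (b, j))
    simp only [mul_assoc, ← Finset.mul_sum, Finset.sum_add_distrib, hz_sum, hw_sum] at h
    linarith
  rw [dotProduct_simplexQuadMatrix_mulVec]
  calc
    _ ≤ ((k : ℝ) / ((k : ℝ) - 1)) * ((∑ j, (∑ b, z (b, j)) * ∑ b, w (b, j)) -
        1 / (k : ℝ) * ∑ j, (∑ b, z (b, j)) * ∑ b, w (b, j)) := by
      gcongr
      exact sum_mul_le_sum_blockSum_mul hz hw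
    _ = ∑ j, (∑ b, z (b, j)) * ∑ b, w (b, j) := by
      have hk_ne : (k : ℝ) ≠ 0 := by linarith
      field_simp [hk_sub.ne']
    _ ≤ 1 := blockSum_le

/-- **Upper pairwise bound (Appendix B).**  If `z ∈ ℝ^{mk}` is feasible then
`zᵀ C̃ z = (k/(k−1))·(‖z‖₂² − 1/k) ≤ 1`, and for any two feasible `z, w`,
`zᵀ C̃ w ≤ 1`. -/
theorem simplexQuadMatrix_pairwise_upper_bound
    (k m : ℕ) (hk : 2 ≤ k) (hm : 1 ≤ m) :
    (∀ z : Fin k × Fin m → ℝ,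
      (∀ p : Fin k × Fin m, 0 ≤ z p) →
      (∑ j : Fin m, (∑ b : Fin k, z (b, j)) ^ 2 = 1) →
        z ⬝ᵥ (simplexQuadMatrix k m *ᵥ z)
            = ((k : ℝ) / ((k : ℝ) - 1)) * ((∑ p : Fin k × Fin m, z p ^ 2) - 1 / (k : ℝ))
        ∧ z ⬝ᵥ (simplexQuadMatrix k m *ᵥ z) ≤ 1)
    ∧ (∀ z w : Fin k × Fin m → ℝ,
      (∀ p : Fin k × Fin m, 0 ≤ z p) →
      (∑ j : Fin m, (∑ b : Fin k, z (b, j)) ^ 2 = 1) →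
      (∀ p : Fin k × Fin m, 0 ≤ w p) →
      (∑ j : Fin m, (∑ b : Fin k, w (b, j)) ^ 2 = 1) →
        z ⬝ᵥ (simplexQuadMatrix k m *ᵥ w) ≤ 1) := by
  refine ⟨fun z hz hz_sum => ⟨?_, ?_⟩, fun z w hz hz_sum hw hw_sum => ?_⟩
  · simp only [dotProduct_simplexQuadMatrix_mulVec, ← pow_two, hz_sum, mul_one]
  · exact dotProduct_simplexQuadMatrix_mulVec_le_one hk hz hz_sum hz hz_sum
  · exact dotProduct_simplexQuadMatrix_mulVec_le_one hk hz hz_sum hw hw_sum
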